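/- Let a, b, B be n×n complex matrices, E : ℝ → ℝ continuous, T > 0, and let U : ℝ → Matrix (Fin n) (Fin n) ℂ satisfy U 0 = 1, U t invertible for all t, and HasDerivAt U ((a + E t • b) * U t) t for all t. Write [X,Y] := X*Y − Y*X. If Tr(Bᴴ * ((U t)⁻¹ * b * U t)) = 0 for all t ∈ [0,T], then for all t ∈ [0,T] the identity E t • Tr(Bᴴ * ((U t)⁻¹ * [b,[b,a]] * U t)) = − Tr(Bᴴ * ((U t)⁻¹ * [a,[b,a]] * U t)) holds. In particular, at any t where the denominator Tr(Bᴴ * ((U t)⁻¹ * [b,[b,a]] * U t)) is nonzero, the singular control satisfies E t = − Tr(Bᴴ * ((U t)⁻¹ * [a,[b,a]] * U t)) / Tr(Bᴴ * ((U t)⁻¹ * [b,[b,a]] * U t)). -/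

import Mathlib

open Matrix

attribute [local instance] Matrix.normedAddCommGroup Matrix.normedSpace

open scoped Ring in
/-- Differentiating the conjugate `U⁻¹ X U` along `U' = g U` gives the conjugate of `[X, g]`. -/
theorem HasDerivAt.ringInverse_mul_mul {R : Type*} [NormedRing R] [NormedAlgebra ℝ R]
    [HasSummableGeomSeries R] {U : ℝ → R} {g : R} {t : ℝ} (hinv : IsUnit (U t))
    (hU : HasDerivAt U (g * U t) t) (X : R) :
    HasDerivAt (fun s => (U s)⁻¹ʳ * X * U s) ((U t)⁻¹ʳ * (X * g - g * X) * U t) t := by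
  obtain ⟨u, hu⟩ := hinv
  have hi : HasDerivAt (fun s => (U s)⁻¹ʳ) (-((U t)⁻¹ʳ * g)) t := by
    have h := hasFDerivAt_ringInverse (𝕜 := ℝ) u
    rw [hu] at h
    refine (h.comp_hasDerivAt t hU).congr_deriv ?_
    simp [← hu, ← mul_assoc]
  refine ((hi.mul_const X).mul hU).congr_deriv ?_
  noncomm_ring

/-- Along `U' = g U`, the trace pairing of `C` with `U⁻¹ X U` has derivative the pairing of `C`
with `U⁻¹ [X, g] U`. -/
theorem hasDerivAt_trace_conj {n : ℕ} {U : ℝ → Matrix (Fin n) (Fin n) ℂ}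
    {g : Matrix (Fin n) (Fin n) ℂ} {t : ℝ} (hinv : IsUnit (U t))
    (hU : HasDerivAt U (g * U t) t) (C X : Matrix (Fin n) (Fin n) ℂ) :
    HasDerivAt (fun s => (C * ((U s)⁻¹ * X * U s)).trace)
      (C * ((U t)⁻¹ * (X * g - g * X) * U t)).trace t := by
  have h : HasDerivAt (fun s => (U s)⁻¹ * X * U s) ((U t)⁻¹ * (X * g - g * X) * U t) t := by
    simp only [Matrix.nonsing_inv_eq_ringInverse]
    exact @HasDerivAt.ringInverse_mul_mul _ Matrix.linftyOpNormedRing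
      Matrix.linftyOpNormedAlgebra inferInstance _ _ _ hinv hU X
  exact (LinearMap.toContinuousLinearMap ((Matrix.traceLinearMap (Fin n) ℝ ℂ).comp
    (LinearMap.mulLeft ℝ C))).hasFDerivAt.comp_hasDerivAt t h

/-- A differentiable function vanishing on a nondegenerate closed interval has vanishing derivative
there, endpoints included. -/
theorem HasDerivAt.eq_zero_of_eqOn_Icc {F : Type*} [NormedAddCommGroup F] [NormedSpace ℝ F]
    {f : ℝ → F} {f' : F} {x y t : ℝ} (hxy : x < y) (hf : ∀ s ∈ Set.Icc x y, f s = 0)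
    (ht : t ∈ Set.Icc x y) (h : HasDerivAt f f' t) : f' = 0 :=
  (uniqueDiffOn_Icc hxy t ht).eq_deriv _ h.hasDerivWithinAt
    ((hasDerivWithinAt_const t _ (0 : F)).congr hf (hf t ht))

/-- The implicit closed-form equation for singular controls: if `U` solves the
Schrödinger equation `dU/dt = (a + E t • b) U`, `U 0 = 1`, and the singular-control
condition `Tr(Bᴴ (U t)⁻¹ b (U t)) = 0` holds on `[0,T]`, then with `[X,Y] = XY - YX`,
`E t • Tr(Bᴴ (U t)⁻¹ [b,[b,a]] (U t)) = - Tr(Bᴴ (U t)⁻¹ [a,[b,a]] (U t))` on `[0,T]`;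
in particular where the denominator is nonzero,
`E t = - Tr(Bᴴ (U t)⁻¹ [a,[b,a]] (U t)) / Tr(Bᴴ (U t)⁻¹ [b,[b,a]] (U t))`. -/
theorem singular_control_closed_form
    (n : ℕ) (a b B : Matrix (Fin n) (Fin n) ℂ) (E : ℝ → ℝ) (hE : Continuous E)
    (T : ℝ) (hT : 0 < T)
    (U : ℝ → Matrix (Fin n) (Fin n) ℂ)
    (hU0 : U 0 = 1)
    (hinv : ∀ t : ℝ, IsUnit (U t))
    (hode : ∀ t : ℝ, HasDerivAt U ((a + E t • b) * U t) t)
    (hsing : ∀ t ∈ Set.Icc (0:ℝ) T, (Bᴴ * ((U t)⁻¹ * b * U t)).trace = 0) :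
    ∀ t ∈ Set.Icc (0:ℝ) T,
      (E t : ℂ) *
          (Bᴴ * ((U t)⁻¹ * (b * (b * a - a * b) - (b * a - a * b) * b) * U t)).trace
        = -(Bᴴ * ((U t)⁻¹ * (a * (b * a - a * b) - (b * a - a * b) * a) * U t)).trace
      ∧ ((Bᴴ * ((U t)⁻¹ * (b * (b * a - a * b) - (b * a - a * b) * b) * U t)).trace ≠ 0 →
          (E t : ℂ) =
            -(Bᴴ * ((U t)⁻¹ * (a * (b * a - a * b) - (b * a - a * b) * a) * U t)).trace /
              (Bᴴ * ((U t)⁻¹ * (b * (b * a - a * b) - (b * a - a * b) * b) * U t)).trace) := by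
  have hfirst : ∀ t ∈ Set.Icc (0:ℝ) T,
      (Bᴴ * ((U t)⁻¹ * (b * a - a * b) * U t)).trace = 0 := by
    intro t ht
    rw [← (hasDerivAt_trace_conj (hinv t) (hode t) Bᴴ b).eq_zero_of_eqOn_Icc hT hsing ht]
    congr 4
    simp only [mul_add, add_mul, mul_smul_comm, smul_mul_assoc]
    abel
  intro t ht
  have hsecond := (hasDerivAt_trace_conj (hinv t) (hode t) Bᴴ
    (b * a - a * b)).eq_zero_of_eqOn_Icc hT hfirst ht
  have hmain : (E t : ℂ) *
      (Bᴴ * ((U t)⁻¹ * (b * (b * a - a * b) - (b * a - a * b) * b) * U t)).trace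
      = -(Bᴴ * ((U t)⁻¹ * (a * (b * a - a * b) - (b * a - a * b) * a) * U t)).trace := by
    generalize b * a - a * b = X at hsecond ⊢
    have hX : X * (a + E t • b) - (a + E t • b) * X
        = -((a * X - X * a) + E t • (b * X - X * b)) := by
      simp only [mul_add, add_mul, mul_smul_comm, smul_mul_assoc, smul_sub]
      abel
    rw [hX] at hsecond
    simp only [mul_neg, neg_mul, mul_add, add_mul, mul_smul_comm, smul_mul_assoc,
      Matrix.trace_neg, Matrix.trace_add, Matrix.trace_smul, Complex.real_smul] at hsecond
    linear_combination -hsecond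
  exact ⟨hmain, fun hne => by rw [eq_div_iff hne, hmain]⟩
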